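/- arXiv:quant-ph/9805082 — 4 statements merged into one kernel-verified Lean document; each statement's English description precedes it below -/
import Mathlib

section
/- Let 0 < a < 1 be a real number and θ ∈ (0, π/2) the angle with sin²θ = a. Define real sequences (k_j) and (ℓ_j) by k_0 = ℓ_0 = 1, k_{j+1} = (1−2a)·k_j + 2(1−a)·ℓ_j, and ℓ_{j+1} = −2a·k_j + (1−2a)·ℓ_j. Then for every natural number j, k_j = sin((2j+1)θ)/√a and ℓ_j = cos((2j+1)θ)/√(1−a). -/
/-- The scalar recurrence of amplitude amplification: if `k_0 = ℓ_0 = 1`,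
`k_{j+1} = (1−2a)k_j + 2(1−a)ℓ_j` and `ℓ_{j+1} = −2a·k_j + (1−2a)ℓ_j`, with `sin²θ = a`,
then `k_j = sin((2j+1)θ)/√a` and `ℓ_j = cos((2j+1)θ)/√(1−a)` for all `j`. -/
theorem stmt6 (a θ : ℝ) (ha0 : 0 < a) (ha1 : a < 1)
    (hθ0 : 0 < θ) (hθ1 : θ < Real.pi / 2) (hθa : Real.sin θ ^ 2 = a)
    (k ℓ : ℕ → ℝ) (hk0 : k 0 = 1) (hℓ0 : ℓ 0 = 1)
    (hk : ∀ j, k (j + 1) = (1 - 2 * a) * k j + 2 * (1 - a) * ℓ j)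
    (hℓ : ∀ j, ℓ (j + 1) = -(2 * a) * k j + (1 - 2 * a) * ℓ j) :
    ∀ j : ℕ, k j = Real.sin ((2 * j + 1) * θ) / Real.sqrt a ∧
      ℓ j = Real.cos ((2 * j + 1) * θ) / Real.sqrt (1 - a) := by
  have hs : 0 < Real.sin θ := Real.sin_pos_of_pos_of_lt_pi hθ0 (by linarith [Real.pi_pos])
  have hc : 0 < Real.cos θ := Real.cos_pos_of_mem_Ioo ⟨by linarith, hθ1⟩
  have hca : 1 - a = Real.cos θ ^ 2 := by
    rw [← hθa]; linarith [Real.sin_sq_add_cos_sq θ]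
  have h1 : Real.sqrt a = Real.sin θ := by rw [← hθa]; exact Real.sqrt_sq hs.le
  have h2 : Real.sqrt (1 - a) = Real.cos θ := by rw [hca]; exact Real.sqrt_sq hc.le
  have key : ∀ j : ℕ, k j * Real.sin θ = Real.sin ((2 * j + 1) * θ) ∧
      ℓ j * Real.cos θ = Real.cos ((2 * j + 1) * θ) := by
    intro j
    induction j with
    | zero => simp [hk0, hℓ0]
    | succ j ih =>
      obtain ⟨i1, i2⟩ := ih
      have e : (2 * ((j + 1 : ℕ) : ℝ) + 1) * θ = (2 * j + 1) * θ + 2 * θ := by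
        push_cast; ring
      have c2 : Real.cos (2 * θ) = 1 - 2 * a := by
        rw [Real.cos_two_mul, ← hca]; ring
      rw [e, Real.sin_add, Real.cos_add, c2, Real.sin_two_mul, ← i1, ← i2, hk, hℓ, hca]
      constructor
      · ring
      · rw [← hθa]; ring
  intro j
  rw [h1, h2, eq_div_iff hs.ne', eq_div_iff hc.ne']
  exact key j
end

section
/- (De-randomization, first method.) Let θ ∈ (0, π/2] be a real number, let m₀ = ⌈π/(4θ) − 1/2⌉ (a nonnegative integer), and set θ₀ = π/(4m₀+2). Then θ₀ ≤ θ, so that a₀ = sin²θ₀ satisfies a₀ ≤ sin²θ, and sin²((2m₀+1)·θ₀) = 1; that is, a quantum algorithm with success probability exactly a₀ succeeds with certainty after m₀ iterations of amplitude amplification. -/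
/-- De-randomization, first method: with `m₀ = ⌈π/(4θ) − 1/2⌉` and `θ₀ = π/(4m₀+2)`,
one has `θ₀ ≤ θ` (so `a₀ = sin²θ₀ ≤ sin²θ`) and `sin²((2m₀+1)θ₀) = 1`. -/
theorem stmt8 (θ : ℝ) (hθ0 : 0 < θ) (hθ1 : θ ≤ Real.pi / 2)
    (m₀ : ℕ) (hm₀ : m₀ = ⌈Real.pi / (4 * θ) - 1 / 2⌉₊)
    (θ₀ : ℝ) (hθ₀ : θ₀ = Real.pi / (4 * m₀ + 2)) :
    θ₀ ≤ θ ∧ Real.sin θ₀ ^ 2 ≤ Real.sin θ ^ 2 ∧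
      Real.sin ((2 * m₀ + 1) * θ₀) ^ 2 = 1 := by
  have hpi := Real.pi_pos
  have hc : Real.pi / (4 * θ) - 1 / 2 ≤ (m₀ : ℝ) := by
    rw [hm₀]; exact Nat.le_ceil _
  have hd : (0 : ℝ) < 4 * m₀ + 2 := by positivity
  have hpos : 0 < θ₀ := by rw [hθ₀]; positivity
  have hle : θ₀ ≤ θ := by
    have h1 : Real.pi / (4 * θ) ≤ (m₀ : ℝ) + 1 / 2 := by linarith
    rw [div_le_iff₀ (by positivity)] at h1
    rw [hθ₀, div_le_iff₀ hd]
    linarith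
  refine ⟨hle, ?_, ?_⟩
  · have h0 : 0 ≤ Real.sin θ₀ :=
      Real.sin_nonneg_of_nonneg_of_le_pi hpos.le (by linarith)
    have h1 : Real.sin θ₀ ≤ Real.sin θ :=
      Real.sin_le_sin_of_le_of_le_pi_div_two (by linarith) hθ1 hle
    exact pow_le_pow_left₀ h0 h1 2
  · have h : (2 * (m₀ : ℝ) + 1) * θ₀ = Real.pi / 2 := by
      rw [hθ₀]; field_simp; ring
    rw [h, Real.sin_pi_div_two]; norm_num
end

section
/- Let θ be a real number with sin(2θ) ≠ 0 and let M be a positive integer. Then ∑_{j=0}^{M−1} sin²((2j+1)θ) = M/2 − sin(4Mθ)/(4·sin(2θ)). Consequently, if 0 < θ < π/2 and M ≥ 1/sin(2θ), then (1/M)·∑_{j=0}^{M−1} sin²((2j+1)θ) ≥ 1/4. -/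
open Finset

/-- `∑_{j=0}^{M−1} sin²((2j+1)θ) = M/2 − sin(4Mθ)/(4 sin(2θ))`; consequently, if
`0 < θ < π/2` and `M ≥ 1/sin(2θ)`, the average of the `sin²((2j+1)θ)` is at least `1/4`. -/
theorem stmt11 (θ : ℝ) (hθ : Real.sin (2 * θ) ≠ 0) (M : ℕ) (hM : 0 < M) :
    (∑ j ∈ range M, Real.sin ((2 * j + 1) * θ) ^ 2
      = M / 2 - Real.sin (4 * M * θ) / (4 * Real.sin (2 * θ))) ∧
    (0 < θ → θ < Real.pi / 2 → (M : ℝ) ≥ 1 / Real.sin (2 * θ) →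
      (1 / M) * ∑ j ∈ range M, Real.sin ((2 * j + 1) * θ) ^ 2 ≥ 1 / 4) := by
  have key : ∀ n : ℕ, ∑ j ∈ range n, Real.sin ((2 * j + 1) * θ) ^ 2
      = n / 2 - Real.sin (4 * n * θ) / (4 * Real.sin (2 * θ)) := by
    intro n
    induction n with
    | zero => simp
    | succ k ih =>
      rw [sum_range_succ, ih]
      have h1 : Real.sin (4 * ((k + 1 : ℕ) : ℝ) * θ)
          = Real.sin (2 * ((2 * k + 1) * θ) + 2 * θ) := by
        congr 1; push_cast; ring
      have h2 : Real.sin (4 * (k : ℝ) * θ)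
          = Real.sin (2 * ((2 * k + 1) * θ) - 2 * θ) := by
        congr 1; ring
      have h3 : Real.cos (2 * ((2 * k + 1) * θ)) = 1 - 2 * Real.sin ((2 * k + 1) * θ) ^ 2 := by
        rw [Real.cos_two_mul, Real.cos_sq']; ring
      rw [h1, h2, Real.sin_add, Real.sin_sub, h3]
      push_cast
      field_simp
      ring
  refine ⟨key M, fun h0 h1 h2 => ?_⟩
  rw [key M]
  have hs : 0 < Real.sin (2 * θ) := Real.sin_pos_of_pos_of_lt_pi (by linarith) (by linarith)
  have hMr : (0 : ℝ) < M := by exact_mod_cast hM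
  have h4 : Real.sin (4 * M * θ) / (4 * Real.sin (2 * θ)) ≤ M / 4 := by
    have h5 : Real.sin (4 * M * θ) / (4 * Real.sin (2 * θ)) ≤ 1 / (4 * Real.sin (2 * θ)) := by
      gcongr
      exact Real.sin_le_one _
    have h6 : 1 / (4 * Real.sin (2 * θ)) = (1 / Real.sin (2 * θ)) / 4 := by
      field_simp
    linarith
  have h7 : (1 / 4 : ℝ) = 1 / M * (M / 4) := by field_simp
  rw [h7]
  apply mul_le_mul_of_nonneg_left _ (by positivity)
  linarith
end

section
/- Let N > 0 and P > 0 be real numbers, and let θ and θ̃ be real numbers in [0, π/2] with |θ̃ − θ| < π/P. Set t = N·sin²θ and t̃ = N·sin²θ̃. Then |t − t̃| < (2π/P)·√(t·N) + (π²/P²)·N. -/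
/-- Accuracy bound of quantum counting: if `θ, θ̃ ∈ [0, π/2]` with `|θ̃ − θ| < π/P`, then
`t = N sin²θ` and `t̃ = N sin²θ̃` satisfy `|t − t̃| < (2π/P)√(tN) + (π²/P²)N`. -/
theorem stmt15 (N P : ℝ) (hN : 0 < N) (hP : 0 < P)
    (θ θ' : ℝ) (hθ0 : 0 ≤ θ) (hθ1 : θ ≤ Real.pi / 2)
    (hθ'0 : 0 ≤ θ') (hθ'1 : θ' ≤ Real.pi / 2)
    (hclose : |θ' - θ| < Real.pi / P)
    (t t' : ℝ) (ht : t = N * Real.sin θ ^ 2) (ht' : t' = N * Real.sin θ' ^ 2) :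
    |t - t'| < (2 * Real.pi / P) * Real.sqrt (t * N) + (Real.pi ^ 2 / P ^ 2) * N := by
  have hs : 0 ≤ Real.sin θ := Real.sin_nonneg_of_nonneg_of_le_pi hθ0 (by linarith [Real.pi_pos])
  have hL : |Real.sin θ' - Real.sin θ| ≤ |θ' - θ| := by
    have h := Real.lipschitzWith_sin.dist_le_mul θ' θ
    simpa [Real.dist_eq] using h
  have hx := abs_lt.mp (lt_of_le_of_lt hL hclose)
  have hsq : Real.sqrt (t * N) = N * Real.sin θ := by
    rw [ht, show N * Real.sin θ ^ 2 * N = (N * Real.sin θ) ^ 2 by ring]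
    exact Real.sqrt_sq (by positivity)
  have he : 0 < Real.pi / P := div_pos Real.pi_pos hP
  rw [hsq, ht, ht', show (2 * Real.pi / P) * (N * Real.sin θ) + (Real.pi ^ 2 / P ^ 2) * N
    = N * (2 * (Real.pi / P) * Real.sin θ + (Real.pi / P) ^ 2) by ring, ← mul_sub, abs_mul,
    abs_of_pos hN]
  refine mul_lt_mul_of_pos_left ?_ hN
  generalize Real.pi / P = e at *
  generalize Real.sin θ = s at *
  obtain ⟨x, hxe⟩ : ∃ x, Real.sin θ' = s + x := ⟨Real.sin θ' - s, by ring⟩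
  rw [hxe] at hx ⊢
  obtain ⟨h1, h2⟩ := hx
  have h3 : -e < x := by linarith
  have h4 : x < e := by linarith
  have h5 : x ^ 2 < e ^ 2 := by nlinarith
  have h6 : s * x ≤ s * e := mul_le_mul_of_nonneg_left h4.le hs
  have h7 : s * (-e) ≤ s * x := mul_le_mul_of_nonneg_left h3.le hs
  rw [abs_lt]
  constructor <;> nlinarith [sq_nonneg x]
end
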